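/- Let (f_j)_{j∈J} be a family of polynomials in r variables with rational coefficients, and let x = (x_1, …, x_r) ∈ ℂ^r be a common zero of all f_j which is an isolated point of the common zero set {y ∈ ℂ^r : f_j(y) = 0 for all j ∈ J} with respect to the Euclidean topology on ℂ^r. Then each coordinate x_i is an algebraic number, i.e. algebraic over ℚ. -/

import Mathlib

open Polynomial Filter Topology IntermediateField

/-- `L` admits a sequence of field embeddings into `ℂ` converging pointwise to the inclusion
and all moving `t`. -/
def NearId (t : ℂ) (L : IntermediateField ℚ ℂ) : Prop :=
  ∃ (h : t ∈ L) (σ : ℕ → L →+* ℂ), (∀ a : L, Tendsto (fun n => σ n a) atTop (𝓝 (a : ℂ))) ∧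
    ∀ n, σ n ⟨t, h⟩ ≠ t

lemma exists_near_root (q : ℂ[X]) (hq : q.Monic) (hd : q.natDegree ≠ 0) (α : ℂ) :
    ∃ z, q.eval z = 0 ∧ ‖z - α‖ ^ q.natDegree ≤ ‖q.eval α‖ := by
  have hs := IsAlgClosed.splits q
  have hcard : q.roots.card = q.natDegree := hs.natDegree_eq_card_roots.symm
  have hne : q.roots.toFinset.Nonempty := by
    rw [Finset.nonempty_iff_ne_empty, Ne, Multiset.toFinset_eq_empty]
    intro h
    rw [h] at hcard
    exact hd hcard.symm
  obtain ⟨z, hz, hmin⟩ := Finset.exists_min_image q.roots.toFinset (fun z => ‖z - α‖) hne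
  simp only [Multiset.mem_toFinset] at hz hmin
  refine ⟨z, (mem_roots'.1 hz).2, ?_⟩
  rw [hs.eval_eq_prod_roots_of_monic hq, ← hcard]
  generalize q.roots = s at hmin
  clear hz hne hcard
  induction s using Multiset.induction_on with
  | empty => simp
  | cons a s ih =>
    simp only [Multiset.card_cons, Multiset.map_cons, Multiset.prod_cons, norm_mul, pow_succ']
    gcongr
    · rw [norm_sub_rev α a]
      exact hmin a (by simp)
    · exact ih fun b hb => hmin b (by simp [hb])

lemma tendsto_eval₂ {L : IntermediateField ℚ ℂ} {σ : ℕ → L →+* ℂ}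
    (hσ : ∀ a : L, Tendsto (fun n => σ n a) atTop (𝓝 (a : ℂ))) {z : ℕ → ℂ} {α : ℂ}
    (hz : Tendsto z atTop (𝓝 α)) (p : L[X]) :
    Tendsto (fun n => p.eval₂ (σ n) (z n)) atTop (𝓝 (aeval α p)) := by
  rw [aeval_def]
  simp only [eval₂_eq_sum_range]
  exact tendsto_finsetSum _ fun i _ => (hσ _).mul (hz.pow i)

lemma NearId.step {t : ℂ} {L : IntermediateField ℚ ℂ} (h : NearId t L) (α : ℂ)
    (hα : IsAlgebraic L α) : ∃ L', L ≤ L' ∧ α ∈ L' ∧ NearId t L' := by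
  obtain ⟨ht, σ, hσ, hne⟩ := h
  have hint : IsIntegral L α := hα.isIntegral
  set m := minpoly L α with hm
  have hmon : m.Monic := minpoly.monic hint
  have hdeg : m.natDegree ≠ 0 := (minpoly.natDegree_pos hint).ne'
  have hz : ∀ n, ∃ z, m.eval₂ (σ n) z = 0 ∧
      ‖z - α‖ ^ m.natDegree ≤ ‖m.eval₂ (σ n) α‖ := by
    intro n
    have := exists_near_root (m.map (σ n)) (hmon.map _) (by rwa [natDegree_map]) α
    simpa only [eval_map, natDegree_map] using this
  choose z hz0 hz using hz
  have hzt : Tendsto z atTop (𝓝 α) := by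
    have h1 : Tendsto (fun n => ‖m.eval₂ (σ n) α‖) atTop (𝓝 0) := by
      have := (tendsto_eval₂ hσ (tendsto_const_nhds (x := α)) m).norm
      rwa [minpoly.aeval, norm_zero] at this
    have h2 : Tendsto (fun n => ‖z n - α‖ ^ m.natDegree) atTop (𝓝 0) :=
      squeeze_zero (fun n => by positivity) hz h1
    have h3 := h2.rpow_const (p := (m.natDegree : ℝ)⁻¹) (Or.inr (by positivity))
    rw [Real.zero_rpow (by simpa using hdeg)] at h3
    rw [tendsto_iff_norm_sub_tendsto_zero]
    refine h3.congr fun n => ?_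
    exact Real.pow_rpow_inv_natCast (norm_nonneg _) hdeg
  let e := adjoinRootEquivAdjoin L hint
  let τ : ℕ → (L⟮α⟯ →+* ℂ) := fun n =>
    (AdjoinRoot.lift (σ n) (z n) (hz0 n)).comp (e.symm : L⟮α⟯ →+* AdjoinRoot m)
  have hτL : ∀ n (a : L), τ n (algebraMap L L⟮α⟯ a) = σ n a := by
    intro n a
    have : e.symm (algebraMap L L⟮α⟯ a) = AdjoinRoot.of m a := e.symm.commutes a
    simp only [τ, RingHom.comp_apply]
    erw [this, AdjoinRoot.lift_of]
  refine ⟨L⟮α⟯.restrictScalars ℚ, ?_, ?_, ?_, τ, ?_, ?_⟩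
  · intro a ha
    exact L⟮α⟯.algebraMap_mem ⟨a, ha⟩
  · exact mem_adjoin_simple_self L α
  · exact L⟮α⟯.algebraMap_mem ⟨t, ht⟩
  · intro a
    obtain ⟨p, hp⟩ := AdjoinRoot.mk_surjective (e.symm a)
    have ha : a = e (AdjoinRoot.mk m p) := by rw [hp]; exact (e.apply_symm_apply a).symm
    have h1 : ∀ n, τ n a = p.eval₂ (σ n) (z n) := by
      intro n
      have : τ n a = AdjoinRoot.lift (σ n) (z n) (hz0 n) (e.symm a) := rfl
      rw [this, ← hp, AdjoinRoot.lift_mk]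
    have h2 : (a : ℂ) = aeval α p := by
      rw [ha]
      have : AdjoinRoot.mk m p = aeval (AdjoinRoot.root m) p := (AdjoinRoot.aeval_eq p).symm
      rw [this, ← aeval_algHom_apply]
      simp only [e]
      erw [adjoinRootEquivAdjoin_apply_root]
      have := aeval_algHom_apply (L⟮α⟯.val) (AdjoinSimple.gen L α) p
      exact this.symm
    rw [h2]
    exact (tendsto_eval₂ hσ hzt p).congr fun n => (h1 n).symm
  · intro n
    have := hτL n ⟨t, ht⟩
    intro h
    exact hne n (this.symm.trans h)

lemma NearId.base (k : IntermediateField ℚ ℂ) (t : ℂ) (ht : Transcendental k t) :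
    NearId t (k⟮t⟯.restrictScalars ℚ) := by
  let q : ℕ → ℚ := fun n => 1 / ((n : ℚ) + 1)
  have hq : ∀ n, q n ≠ 0 := fun n => by positivity
  let s : ℕ → ℂ := fun n => t + (q n : ℂ)
  have hs : ∀ n, Transcendental k (s n) := by
    intro n h
    apply ht
    have : t = s n - algebraMap k ℂ (q n : k) := by simp [s]
    rw [this]
    exact h.sub (isAlgebraic_algebraMap _)
  have hst : Tendsto s atTop (𝓝 t) := by
    have : Tendsto (fun n : ℕ => t + 1 / ((n : ℂ) + 1)) atTop (𝓝 (t + 0)) :=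
      tendsto_const_nhds.add tendsto_one_div_add_atTop_nhds_zero_nat
    simpa [s, q] using this
  let e := RatFunc.algEquivOfTranscendental t ht
  let τ : ℕ → (k⟮t⟯ →ₐ[k] ℂ) := fun n =>
    (k⟮s n⟯.val.comp (RatFunc.algEquivOfTranscendental (s n) (hs n)).toAlgHom).comp
      e.symm.toAlgHom
  refine ⟨mem_adjoin_simple_self k t, fun n => (τ n).toRingHom, ?_, ?_⟩
  · intro a
    let u := e.symm a
    have h1 : ∀ n, τ n a = aeval (s n) u.num / aeval (s n) u.denom := fun n =>
      RatFunc.algEquivOfTranscendental_apply (s n) (hs n) u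
    have h2 : (a : ℂ) = aeval t u.num / aeval t u.denom := by
      rw [← RatFunc.algEquivOfTranscendental_apply t ht u]
      exact congrArg _ (e.apply_symm_apply a).symm
    have hden : aeval t u.denom ≠ 0 := fun h =>
      u.denom_ne_zero ((transcendental_iff.1 ht) _ h)
    have hc : ∀ p : k[X], Tendsto (fun n => aeval (s n) p) atTop (𝓝 (aeval t p)) := fun p =>
      (p.continuous_aeval.tendsto t).comp hst
    rw [h2]
    exact ((hc _).div (hc _) hden).congr fun n => (h1 n).symm
  · intro n
    have h1 : τ n (AdjoinSimple.gen k t) = s n := by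
      simp only [τ, AlgHom.comp_apply]
      have : e.symm (AdjoinSimple.gen k t) = RatFunc.X :=
        RatFunc.algEquivOfTranscendental_symm_gen t ht
      erw [this]
      exact RatFunc.algEquivOfTranscendental_X (s n) (hs n)
    intro h
    have h2 : s n = t := h1.symm.trans h
    exact hq n (by simpa [s] using h2)

open scoped IntermediateField.algebraAdjoinAdjoin in
lemma exists_base (t : ℂ) (ht : Transcendental ℚ t) :
    ∃ L : IntermediateField ℚ ℂ, NearId t L ∧ ∀ a : ℂ, IsAlgebraic L a := by
  have hI : AlgebraicIndepOn ℚ id ({t} : Set ℂ) := by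
    exact algebraicIndependent_singleton_iff (⟨t, rfl⟩ : ({t} : Set ℂ)) |>.2 ht
  obtain ⟨B, hB, hTB⟩ := exists_isTranscendenceBasis_superset hI
  have htB : t ∈ B := hB rfl
  let k : IntermediateField ℚ ℂ := adjoin ℚ (B \ {t})
  have hk : Transcendental k t := by
    have h1 := hTB.1.transcendental_adjoin (s := {⟨t, htB⟩}ᶜ) (i := ⟨t, htB⟩) (by simp)
    have h2 : ((↑) : B → ℂ) '' {⟨t, htB⟩}ᶜ = B \ {t} := by
      ext y; simp
    rw [h2] at h1
    intro h3
    apply h1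
    exact (IsFractionRing.isAlgebraic_iff (Algebra.adjoin ℚ (B \ {t})) k ℂ).2 h3
  refine ⟨_, NearId.base k t hk, ?_⟩
  have halg := hTB.isAlgebraic_field
  have heq : k⟮t⟯.restrictScalars ℚ = adjoin ℚ (Set.range ((↑) : B → ℂ)) := by
    refine Eq.trans (adjoin_adjoin_left ℚ (B \ {t}) {t}) ?_
    congr 1
    ext y; simp; grind
  rw [heq]
  exact halg.isAlgebraic

theorem isolated_zero_algebraic {r : ℕ} {J : Type*} (f : J → MvPolynomial (Fin r) ℚ)
    (x : Fin r → ℂ)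
    (hzero : ∀ j, MvPolynomial.aeval x (f j) = 0)
    (hiso : ∃ U ∈ nhds x,
      U ∩ {y : Fin r → ℂ | ∀ j, MvPolynomial.aeval y (f j) = 0} = {x}) :
    ∀ i, IsAlgebraic ℚ (x i) := by
  intro i
  by_contra hi
  obtain ⟨L₀, h₀, halg⟩ := exists_base (x i) hi
  have key : ∀ s : Finset (Fin r), ∃ L : IntermediateField ℚ ℂ, L₀ ≤ L ∧ (∀ j ∈ s, x j ∈ L) ∧
      NearId (x i) L := by
    intro s
    induction s using Finset.induction_on with
    | empty => exact ⟨L₀, le_rfl, by simp, h₀⟩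
    | insert a s _ ih =>
      obtain ⟨L, hL, hs, hN⟩ := ih
      have hα : IsAlgebraic L (x a) := by
        let : Algebra L₀ L := (IntermediateField.inclusion hL).toRingHom.toAlgebra
        have : IsScalarTower L₀ L ℂ := IsScalarTower.of_algebraMap_eq (congrFun rfl)
        exact (halg (x a)).tower_top L
      obtain ⟨L', h1, h2, h3⟩ := hN.step (x a) hα
      refine ⟨L', hL.trans h1, ?_, h3⟩
      intro j hj
      rcases Finset.mem_insert.1 hj with rfl | hj
      · exact h2
      · exact h1 (hs j hj)
  obtain ⟨L, -, hx, ht, σ, hσ, hne⟩ := key Finset.univ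
  obtain ⟨U, hU, hUx⟩ := hiso
  let X : Fin r → L := fun j => ⟨x j, hx j (Finset.mem_univ j)⟩
  have hconv : Tendsto (fun n j => σ n (X j)) atTop (𝓝 x) :=
    tendsto_pi_nhds.2 fun j => hσ (X j)
  obtain ⟨n, hn⟩ := (hconv.eventually_mem hU).exists
  have hX : ∀ j, MvPolynomial.aeval X (f j) = 0 := by
    intro j
    have h1 := MvPolynomial.aeval_algebraMap_apply ℂ X (f j)
    have h2 : (fun j => algebraMap L ℂ (X j)) = x := rfl
    have h3 : MvPolynomial.aeval (algebraMap L ℂ ∘ X) (f j) = 0 := hzero j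
    rw [h3] at h1
    exact (map_eq_zero (algebraMap L ℂ)).1 h1.symm
  have hmem : (fun j => σ n (X j)) ∈
      U ∩ {y : Fin r → ℂ | ∀ j, MvPolynomial.aeval y (f j) = 0} := by
    refine ⟨hn, fun j => ?_⟩
    have h1 := MvPolynomial.comp_aeval_apply (f := X) (σ n).toRatAlgHom (f j)
    rw [hX j, map_zero] at h1
    exact h1.symm
  rw [hUx] at hmem
  exact hne n (congrFun hmem i)
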